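/- Let α ∈ (0,1), let β₀, β₁ ∈ ℝ satisfy β₁ ≠ 0, let T > 0, and let y and z both be classical solutions of the degenerate Robin problem on (0,1)×(0,T). Define p(t) = ∫₀¹ y(x,t)·z(x,T−t) dx for t ∈ (0,T), and assume p is differentiable on (0,T) with p′(t) = ∫₀¹ ( ∂ₜy(x,t)·z(x,T−t) − y(x,t)·(∂ₜz)(x,T−t) ) dx. Then p is constant on (0,T). -/

import Mathlib

open MeasureTheory Set

/-- A classical solution of the degenerate Robin problem on `(0,1) × (0,T)`:
`u` is the solution and `v` is the continuous extension of `x ↦ x^α ∂ₓ u`. -/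
structure IsDegRobinSol (α β₀ β₁ T : ℝ) (u v : ℝ → ℝ → ℝ) : Prop where
  cont_u : ContinuousOn (fun p : ℝ × ℝ => u p.1 p.2) (Icc 0 1 ×ˢ Icc 0 T)
  contDiff_x : ∀ t ∈ Icc (0:ℝ) T, ContDiffOn ℝ 2 (fun x => u x t) (Ioo 0 1)
  diff_t : ∀ x ∈ Ioo (0:ℝ) 1, ∀ t ∈ Ioo (0:ℝ) T, DifferentiableAt ℝ (fun s => u x s) t
  cont_ut : ContinuousOn (fun p : ℝ × ℝ => deriv (fun s => u p.1 s) p.2)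
      (Ioo 0 1 ×ˢ Ioo 0 T)
  cont_v : ContinuousOn (fun p : ℝ × ℝ => v p.1 p.2) (Icc 0 1 ×ˢ Icc 0 T)
  v_eq : ∀ t ∈ Icc (0:ℝ) T, ∀ x ∈ Ioo (0:ℝ) 1, v x t = x ^ α * deriv (fun y => u y t) x
  diff_v : ∀ t ∈ Icc (0:ℝ) T, ∀ x ∈ Ioo (0:ℝ) 1, DifferentiableAt ℝ (fun y => v y t) x
  pde : ∀ x ∈ Ioo (0:ℝ) 1, ∀ t ∈ Ioo (0:ℝ) T,
      deriv (fun s => u x s) t = deriv (fun y => v y t) x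
  robin : ∀ t ∈ Icc (0:ℝ) T, β₀ * u 0 t = β₁ * v 0 t
  dirichlet : ∀ t ∈ Icc (0:ℝ) T, u 1 t = 0
  int_u : ∀ t ∈ Icc (0:ℝ) T, IntegrableOn (fun x => (u x t) ^ 2) (Ioo 0 1)
  int_ux : ∀ t ∈ Icc (0:ℝ) T,
      IntegrableOn (fun x => x ^ α * (deriv (fun y => u y t) x) ^ 2) (Ioo 0 1)

/-- Conservation of the duality pairing between a solution and the time-reversed
adjoint solution of the degenerate Robin problem. -/
theorem duality_pairing_constant (α β₀ β₁ T : ℝ) (hα : α ∈ Ioo (0:ℝ) 1)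
    (hβ₁ : β₁ ≠ 0) (hT : 0 < T)
    (y vy z vz : ℝ → ℝ → ℝ)
    (hy : IsDegRobinSol α β₀ β₁ T y vy) (hz : IsDegRobinSol α β₀ β₁ T z vz)
    (p : ℝ → ℝ) (hp : ∀ t, p t = ∫ x in Ioo (0:ℝ) 1, y x t * z x (T - t))
    (hp' : ∀ t ∈ Ioo (0:ℝ) T,
      HasDerivAt p
        (∫ x in Ioo (0:ℝ) 1,
          (deriv (fun s => y x s) t * z x (T - t)
            - y x t * deriv (fun s => z x s) (T - t))) t) :
    ∀ t₁ ∈ Ioo (0:ℝ) T, ∀ t₂ ∈ Ioo (0:ℝ) T, p t₁ = p t₂ := by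
  have key : ∀ t ∈ Ioo (0:ℝ) T, HasDerivAt p 0 t := by
    intro t ht
    have ht' : T - t ∈ Ioo (0:ℝ) T := ⟨by linarith [ht.2], by linarith [ht.1]⟩
    have htc := Ioo_subset_Icc_self ht
    have htc' := Ioo_subset_Icc_self ht'
    have h := hp' t ht
    have slice : ∀ (f : ℝ → ℝ → ℝ) (s : ℝ), s ∈ Icc (0:ℝ) T →
        ContinuousOn (fun q : ℝ × ℝ => f q.1 q.2) (Icc 0 1 ×ˢ Icc 0 T) →
        ContinuousOn (fun x => f x s) (Icc 0 1) := by
      intro f s hs hf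
      exact hf.comp (f := fun x : ℝ => (x, s)) (by fun_prop) (fun x hx => ⟨hx, hs⟩)
    have diffx : ∀ (u v : ℝ → ℝ → ℝ), IsDegRobinSol α β₀ β₁ T u v → ∀ s ∈ Icc (0:ℝ) T,
        ∀ x ∈ Ioo (0:ℝ) 1,
        HasDerivAt (fun x => u x s) (deriv (fun x => u x s) x) x := by
      intro u v hu s hs x hx
      exact (((hu.contDiff_x s hs).differentiableOn (by norm_num)).differentiableAt
        (isOpen_Ioo.mem_nhds hx)).hasDerivAt
    convert h using 1
    symm
    by_cases hint : IntegrableOn (fun x => deriv (fun s => y x s) t * z x (T - t)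
            - y x t * deriv (fun s => z x s) (T - t)) (Ioo (0:ℝ) 1)
    · have hc : ContinuousOn (fun x => vy x t * z x (T - t) - y x t * vz x (T - t))
          (Icc (0:ℝ) 1) :=
        ((slice vy t htc hy.cont_v).mul (slice z _ htc' hz.cont_u)).sub
          ((slice y t htc hy.cont_u).mul (slice vz _ htc' hz.cont_v))
      have hF := intervalIntegral.integral_eq_sub_of_hasDerivAt_of_le (zero_le_one (α := ℝ)) hc
        (f' := fun x => deriv (fun s => y x s) t * z x (T - t)
            - y x t * deriv (fun s => z x s) (T - t))
        (by
          intro x hx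
          have h1 := (hy.diff_v t htc x hx).hasDerivAt
          have h2 := (hz.diff_v _ htc' x hx).hasDerivAt
          have h3 := diffx y vy hy t htc x hx
          have h4 := diffx z vz hz _ htc' x hx
          have h5 := (h1.mul h4).sub (h3.mul h2)
          refine HasDerivAt.congr_deriv h5 ?_
          rw [hy.pde x hx t ht, hz.pde x hx _ ht', hy.v_eq t htc x hx, hz.v_eq _ htc' x hx]
          ring)
        ((intervalIntegrable_iff_integrableOn_Ioo_of_le zero_le_one).2 hint)
      rw [intervalIntegral.integral_of_le zero_le_one, integral_Ioc_eq_integral_Ioo] at hF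
      rw [hF, hy.dirichlet t htc, hz.dirichlet _ htc']
      have r1 := hy.robin t htc
      have r2 := hz.robin _ htc'
      apply mul_left_cancel₀ hβ₁
      linear_combination z 0 (T - t) * r1 - y 0 t * r2
    · exact integral_undef hint
  intro t₁ h₁ t₂ h₂
  exact isOpen_Ioo.is_const_of_deriv_eq_zero isPreconnected_Ioo
    (fun t ht => (key t ht).differentiableAt.differentiableWithinAt)
    (fun t ht => (key t ht).deriv) h₁ h₂
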